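/- arXiv:0906.3750 — 3 statements merged into one kernel-verified Lean document; each statement's English description precedes it below -/
import Mathlib

section
/- Let K be a nontrivially normed field which is a proper metric space (a local field), Γ a finitely generated group, n : ℕ, and ρ : Γ →* GL_n(K) a group homomorphism. Suppose σ and σ' are two semisimple group homomorphisms Γ →* GL_n(K) that both lie in the closure of the conjugation orbit of ρ: there are sequences (g_k), (g'_k) in GL_n(K) with g_k ρ(γ) g_k⁻¹ → σ(γ) and g'_k ρ(γ) (g'_k)⁻¹ → σ'(γ) entrywise for every γ ∈ Γ. Then σ and σ' are conjugate: there exists h ∈ GL_n(K) with σ'(γ) = h · σ(γ) · h⁻¹ for all γ ∈ Γ. -/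
open Filter Topology
open scoped Matrix

/-- A representation `ρ : Γ →* GL_n(K)` is semisimple if every `ρ`-invariant subspace of
`K^n` admits a `ρ`-invariant complement. -/
def IsSemisimpleRep {K : Type*} [Field K] {n : ℕ} {Γ : Type*} [Group Γ]
    (ρ : Γ →* Matrix.GeneralLinearGroup (Fin n) K) : Prop :=
  ∀ W : Submodule K (Fin n → K),
    (∀ γ : Γ, ∀ w ∈ W, (ρ γ : Matrix (Fin n) (Fin n) K) *ᵥ w ∈ W) →
    ∃ W' : Submodule K (Fin n → K),
      (∀ γ : Γ, ∀ w ∈ W', (ρ γ : Matrix (Fin n) (Fin n) K) *ᵥ w ∈ W') ∧ IsCompl W W'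

section SemisimpleModules

variable {K A : Type*} [Field K] [Ring A] [Algebra K A]

/-- Two finite-dimensional semisimple modules without nonzero homomorphisms between them are
separated by a scalar acting as `1` on the first and as `0` on the second. -/
theorem exists_smul_eq_self_and_smul_eq_zero {S N : Type*}
    [AddCommGroup S] [Module K S] [Module A S] [IsScalarTower K A S] [FiniteDimensional K S]
    [AddCommGroup N] [Module K N] [Module A N] [IsScalarTower K A N] [FiniteDimensional K N]
    [IsSemisimpleModule A S] [IsSemisimpleModule A N]
    (hSN : ∀ f : S →ₗ[A] N, f = 0) (hNS : ∀ f : N →ₗ[A] S, f = 0) :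
    ∃ a : A, (∀ s : S, a • s = s) ∧ ∀ x : N, a • x = 0 := by
  let p : Module.End (Module.End A (S × N)) (S × N) :=
    { toFun := fun x => (x.1, 0)
      map_add' := fun x y => by simp
      map_smul' := fun f x => by
        have h1 : (f (x.1, 0)).2 = 0 :=
          LinearMap.congr_fun (hSN (LinearMap.snd A S N ∘ₗ f ∘ₗ LinearMap.inl A S N)) x.1
        have h2 : (f (0, x.2)).1 = 0 :=
          LinearMap.congr_fun (hNS (LinearMap.fst A S N ∘ₗ f ∘ₗ LinearMap.inr A S N)) x.2
        have h3 : f x = f (x.1, 0) + f (0, x.2) := by rw [← map_add]; simp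
        ext <;> simp [h1, h2, h3] }
  have : IsSemisimpleModule A (S × N) := by
    have hsup := IsSemisimpleModule.sup (IsSemisimpleModule.range (LinearMap.inl A S N))
      (IsSemisimpleModule.range (LinearMap.inr A S N))
    rw [LinearMap.sup_range_inl_inr] at hsup
    exact IsSemisimpleModule.congr Submodule.topEquiv.symm
  obtain ⟨t, ht⟩ := (Module.Finite.fg_top : (⊤ : Submodule K (S × N)).FG)
  obtain ⟨a, ha⟩ := jacobson_density (R := A) p t
  have key : ∀ x : S × N, a • x = (x.1, 0) := by
    have : Algebra.lsmul K K (S × N) a = LinearMap.inl K S N ∘ₗ LinearMap.fst K S N :=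
      LinearMap.ext_on ht fun x hx => (ha x hx).symm
    exact fun x => LinearMap.congr_fun this x
  exact ⟨a, fun s => congrArg Prod.fst (key (s, 0)), fun x => congrArg Prod.snd (key (0, x))⟩

/-- **Brauer–Nesbitt**: two semisimple modules of the same finite dimension over the base field
on which every scalar has the same characteristic polynomial are isomorphic. -/
theorem nonempty_linearEquiv_of_charpoly_lsmul_eq (d : ℕ) {M N : Type*}
    [AddCommGroup M] [Module K M] [Module A M] [IsScalarTower K A M] [FiniteDimensional K M]
    [AddCommGroup N] [Module K N] [Module A N] [IsScalarTower K A N] [FiniteDimensional K N]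
    [IsSemisimpleModule A M] [IsSemisimpleModule A N]
    (hM : Module.finrank K M = d) (hN : Module.finrank K N = d)
    (h : ∀ a : A, (Algebra.lsmul K K M a).charpoly = (Algebra.lsmul K K N a).charpoly) :
    Nonempty (M ≃ₗ[A] N) := by
  induction d using Nat.strong_induction_on generalizing M N with
  | _ d ih =>
  rcases subsingleton_or_nontrivial M with _ | _
  · have : Subsingleton N := by
      rw [← Module.finrank_zero_iff (R := K), hN, ← hM]
      exact Module.finrank_zero_of_subsingleton
    exact ⟨0, 0, fun _ => Subsingleton.elim _ _, fun _ => Subsingleton.elim _ _⟩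
  obtain ⟨S, hS⟩ := IsSemisimpleModule.exists_simple_submodule A M
  have : FiniteDimensional K S := inferInstanceAs (FiniteDimensional K (S.restrictScalars K))
  obtain ⟨f, hf⟩ : ∃ f : S →ₗ[A] N, f ≠ 0 := by
    by_contra! hSN
    have hNS : ∀ f : N →ₗ[A] S, f = 0 := by
      intro f
      by_contra hf
      have hsurj := f.surjective_of_ne_zero hf
      obtain ⟨g, hg⟩ := IsSemisimpleModule.lifting_property f hsurj LinearMap.id
      rw [hSN g, LinearMap.comp_zero] at hg
      have := IsSimpleModule.nontrivial A S
      obtain ⟨s, hs⟩ := exists_ne (0 : S)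
      exact hs (LinearMap.congr_fun hg s).symm
    obtain ⟨a, ha1, ha0⟩ := exists_smul_eq_self_and_smul_eq_zero (K := K) hSN hNS
    have h0 : Algebra.lsmul K K N a = 0 := LinearMap.ext ha0
    have hc := (Algebra.lsmul K K M a).aeval_self_charpoly
    rw [h, h0, LinearMap.charpoly_zero, map_pow, Polynomial.aeval_X] at hc
    have := IsSimpleModule.nontrivial A S
    obtain ⟨s, hs⟩ := exists_ne (0 : S)
    have hpow : ∀ k : ℕ, ((Algebra.lsmul K K M a) ^ k) (s : M) = s := by
      intro k
      induction k with
      | zero => simp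
      | succ k ihk =>
        have hs1 : Algebra.lsmul K K M a s = s := congrArg Subtype.val (ha1 s)
        rw [pow_succ, Module.End.mul_apply, hs1, ihk]
    apply hs
    ext
    rw [← hpow (Module.finrank K N), hc]
    simp
  have hinj := f.injective_of_ne_zero hf
  let T := LinearMap.range f
  let e : S ≃ₗ[A] T := LinearEquiv.ofInjective f hinj
  obtain ⟨S', hS'⟩ := exists_isCompl S
  obtain ⟨T', hT'⟩ := exists_isCompl T
  have : FiniteDimensional K S' := inferInstanceAs (FiniteDimensional K (S'.restrictScalars K))
  have : FiniteDimensional K T := inferInstanceAs (FiniteDimensional K (T.restrictScalars K))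
  have : FiniteDimensional K T' := inferInstanceAs (FiniteDimensional K (T'.restrictScalars K))
  let eM : (S × S') ≃ₗ[A] M := S.prodEquivOfIsCompl S' hS'
  let eN : (S × T') ≃ₗ[A] N :=
    (e.prodCongr (LinearEquiv.refl A T')).trans (T.prodEquivOfIsCompl T' hT')
  have hdM := (eM.restrictScalars K).finrank_eq
  have hdN := (eN.restrictScalars K).finrank_eq
  rw [Module.finrank_prod] at hdM hdN
  have := IsSimpleModule.nontrivial A S
  have hpos : 0 < Module.finrank K S := Module.finrank_pos
  obtain ⟨e'⟩ := ih (Module.finrank K S') (by omega) (M := S') (N := T') rfl (by omega) fun a => by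
    have hM' : (Algebra.lsmul K K M a).charpoly =
        (Algebra.lsmul K K S a).charpoly * (Algebra.lsmul K K S' a).charpoly := by
      rw [← LinearMap.charpoly_prodMap, ← (eM.restrictScalars K).charpoly_conj]
      congr 1
      ext x
      simp [LinearEquiv.conj_apply, ← Prod.smul_def]
    have hN' : (Algebra.lsmul K K N a).charpoly =
        (Algebra.lsmul K K S a).charpoly * (Algebra.lsmul K K T' a).charpoly := by
      rw [← LinearMap.charpoly_prodMap, ← (eN.restrictScalars K).charpoly_conj]
      congr 1
      ext x
      simp [LinearEquiv.conj_apply, ← Prod.smul_def]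
    have := h a
    rw [hM', hN'] at this
    exact mul_left_cancel₀ (LinearMap.charpoly_monic _).ne_zero this
  exact ⟨eM.symm.trans (((LinearEquiv.refl A S).prodCongr e').trans eN)⟩

end SemisimpleModules

section MatrixRepresentations

variable {K Γ : Type*} [Group Γ] {n : ℕ}

/-- The representation on `K^n` given by a homomorphism to `GL_n(K)`. -/
noncomputable def matrixRepresentation [Field K] (σ : Γ →* Matrix.GeneralLinearGroup (Fin n) K) :
    Representation K Γ (Fin n → K) :=
  (Matrix.toLinAlgEquiv' : Matrix (Fin n) (Fin n) K ≃ₐ[K] _).toAlgHom.toMonoidHom.comp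
    ((Units.coeHom _).comp σ)

theorem matrixRepresentation_apply [Field K] (σ : Γ →* Matrix.GeneralLinearGroup (Fin n) K)
    (γ : Γ) (v : Fin n → K) :
    matrixRepresentation σ γ v = (σ γ : Matrix (Fin n) (Fin n) K) *ᵥ v := rfl

/-- The linear extension to the group algebra of a homomorphism to `GL_n(K)`. -/
noncomputable def groupAlgebraToMatrix [Field K] (σ : Γ →* Matrix.GeneralLinearGroup (Fin n) K) :
    MonoidAlgebra K Γ →ₐ[K] Matrix (Fin n) (Fin n) K :=
  MonoidAlgebra.lift K _ Γ ((Units.coeHom _).comp σ)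

theorem groupAlgebraToMatrix_single [Field K] (σ : Γ →* Matrix.GeneralLinearGroup (Fin n) K)
    (γ : Γ) (c : K) :
    groupAlgebraToMatrix σ (MonoidAlgebra.single γ c) =
      c • (σ γ : Matrix (Fin n) (Fin n) K) := by
  simp [groupAlgebraToMatrix]

theorem asAlgebraHom_matrixRepresentation [Field K]
    (σ : Γ →* Matrix.GeneralLinearGroup (Fin n) K) (a : MonoidAlgebra K Γ) :
    (matrixRepresentation σ).asAlgebraHom a = Matrix.toLin' (groupAlgebraToMatrix σ a) := by
  induction a using MonoidAlgebra.induction_linear with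
  | zero => simp
  | add x y hx hy => simp [hx, hy]
  | single γ c =>
    rw [Representation.asAlgebraHom_single, groupAlgebraToMatrix_single, map_smul]
    rfl

theorem charpoly_lsmul_asModule_matrixRepresentation [Field K]
    (σ : Γ →* Matrix.GeneralLinearGroup (Fin n) K) (a : MonoidAlgebra K Γ) :
    (Algebra.lsmul K K (matrixRepresentation σ).asModule a).charpoly =
      (groupAlgebraToMatrix σ a).charpoly := by
  rw [← Matrix.charpoly_toLin', ← asAlgebraHom_matrixRepresentation,
    ← (matrixRepresentation σ).asModuleEquiv.charpoly_conj]
  congr 1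

theorem IsSemisimpleRep.isSemisimpleModule [Field K]
    {σ : Γ →* Matrix.GeneralLinearGroup (Fin n) K} (hσ : IsSemisimpleRep σ) :
    IsSemisimpleModule (MonoidAlgebra K Γ) (matrixRepresentation σ).asModule := by
  rw [← Representation.isSemisimpleRepresentation_iff_isSemisimpleModule_asModule]
  refine ⟨fun W => ?_⟩
  obtain ⟨W', hW', hc⟩ := hσ W.toSubmodule fun γ w hw => W.apply_mem_toSubmodule γ hw
  refine ⟨⟨W', fun γ w hw => hW' γ w hw⟩, ?_⟩
  rw [isCompl_iff, disjoint_iff, codisjoint_iff] at hc ⊢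
  exact ⟨Subrepresentation.toSubmodule_injective hc.1,
    Subrepresentation.toSubmodule_injective hc.2⟩

/-- A limit of conjugates of `ρ` has the same characteristic polynomials as `ρ` on the group
algebra. -/
theorem charpoly_groupAlgebraToMatrix_eq_of_tendsto [NontriviallyNormedField K]
    {ρ σ : Γ →* Matrix.GeneralLinearGroup (Fin n) K}
    {g : ℕ → Matrix.GeneralLinearGroup (Fin n) K}
    (hconv : ∀ γ : Γ, Tendsto
      (fun k : ℕ => ((g k * ρ γ * (g k)⁻¹ : Matrix.GeneralLinearGroup (Fin n) K) :
        Matrix (Fin n) (Fin n) K))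
      atTop (𝓝 (σ γ : Matrix (Fin n) (Fin n) K))) (a : MonoidAlgebra K Γ) :
    (groupAlgebraToMatrix σ a).charpoly = (groupAlgebraToMatrix ρ a).charpoly := by
  have hlim : Tendsto (fun k => (g k : Matrix (Fin n) (Fin n) K) * groupAlgebraToMatrix ρ a *
      ((g k)⁻¹ : Matrix.GeneralLinearGroup (Fin n) K).val) atTop
      (𝓝 (groupAlgebraToMatrix σ a)) := by
    induction a using MonoidAlgebra.induction_linear with
    | zero => simp
    | add x y hx hy => simpa only [map_add, mul_add, add_mul] using hx.add hy
    | single γ c =>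
      simpa only [groupAlgebraToMatrix_single, Units.val_mul, Matrix.mul_smul, Matrix.smul_mul]
        using (hconv γ).const_smul c
  refine Polynomial.funext fun t => ?_
  have hdet : Continuous fun M : Matrix (Fin n) (Fin n) K => M.charpoly.eval t := by
    simp only [Matrix.eval_charpoly]
    fun_prop
  refine tendsto_nhds_unique ((hdet.tendsto _).comp hlim) ?_
  refine tendsto_const_nhds.congr fun k => ?_
  simp only [Function.comp_apply, Matrix.coe_units_inv, Matrix.charpoly_units_conj]

/-- An isomorphism between the group algebra modules of two matrix representations conjugates
one representation to the other. -/
theorem exists_conj_of_asModule_linearEquiv [Field K]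
    {σ σ' : Γ →* Matrix.GeneralLinearGroup (Fin n) K}
    (e : (matrixRepresentation σ).asModule ≃ₗ[MonoidAlgebra K Γ]
      (matrixRepresentation σ').asModule) :
    ∃ h : Matrix.GeneralLinearGroup (Fin n) K, ∀ γ : Γ, σ' γ = h * σ γ * h⁻¹ := by
  let f : (Fin n → K) ≃ₗ[K] (Fin n → K) :=
    (matrixRepresentation σ).asModuleEquiv.symm.trans
      ((e.restrictScalars K).trans (matrixRepresentation σ').asModuleEquiv)
  have hf : ∀ γ v, f ((σ γ : Matrix (Fin n) (Fin n) K) *ᵥ v) =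
      (σ' γ : Matrix (Fin n) (Fin n) K) *ᵥ f v := by
    intro γ v
    simp only [f, LinearEquiv.trans_apply, LinearEquiv.restrictScalars_apply]
    rw [← matrixRepresentation_apply, Representation.asModuleEquiv_symm_map_rho, map_smul,
      Representation.asModuleEquiv_map_smul, Representation.asAlgebraHom_of,
      matrixRepresentation_apply]
  let h : Matrix.GeneralLinearGroup (Fin n) K :=
    Matrix.GeneralLinearGroup.toLin.symm (LinearMap.GeneralLinearGroup.ofLinearEquiv f)
  have hh : ∀ v, (h : Matrix (Fin n) (Fin n) K) *ᵥ v = f v := by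
    intro v
    exact LinearMap.congr_fun (Matrix.toLin'_toMatrix' (f : (Fin n → K) →ₗ[K] (Fin n → K))) v
  refine ⟨h, fun γ => eq_mul_inv_of_mul_eq (Units.ext (Matrix.toLin'.injective ?_))⟩
  refine LinearMap.ext fun v => ?_
  simp only [Matrix.toLin'_apply, Units.val_mul, ← Matrix.mulVec_mulVec, hh, hf]

end MatrixRepresentations

/-- Over a local field, two semisimple representations `σ, σ'` lying in the
closure of the conjugation orbit of the same representation `ρ` are conjugate. -/
theorem stmt15 {K : Type*} [NontriviallyNormedField K] [ProperSpace K]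
    {Γ : Type*} [Group Γ] [Group.FG Γ] {n : ℕ}
    (ρ σ σ' : Γ →* Matrix.GeneralLinearGroup (Fin n) K)
    (hσ : IsSemisimpleRep σ) (hσ' : IsSemisimpleRep σ')
    (g g' : ℕ → Matrix.GeneralLinearGroup (Fin n) K)
    (hconv : ∀ γ : Γ,
      Tendsto
        (fun k : ℕ =>
          ((g k * ρ γ * (g k)⁻¹ : Matrix.GeneralLinearGroup (Fin n) K) :
            Matrix (Fin n) (Fin n) K))
        atTop (nhds ((σ γ : Matrix (Fin n) (Fin n) K))))
    (hconv' : ∀ γ : Γ,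
      Tendsto
        (fun k : ℕ =>
          ((g' k * ρ γ * (g' k)⁻¹ : Matrix.GeneralLinearGroup (Fin n) K) :
            Matrix (Fin n) (Fin n) K))
        atTop (nhds ((σ' γ : Matrix (Fin n) (Fin n) K)))) :
    ∃ h : Matrix.GeneralLinearGroup (Fin n) K, ∀ γ : Γ, σ' γ = h * σ γ * h⁻¹ := by
  have := hσ.isSemisimpleModule
  have := hσ'.isSemisimpleModule
  have hdim : ∀ τ : Γ →* Matrix.GeneralLinearGroup (Fin n) K,
      Module.finrank K (matrixRepresentation τ).asModule = n := fun τ => by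
    rw [(matrixRepresentation τ).asModuleEquiv.finrank_eq, Module.finrank_fin_fun]
  obtain ⟨e⟩ := nonempty_linearEquiv_of_charpoly_lsmul_eq (K := K) (A := MonoidAlgebra K Γ) n
    (hdim σ) (hdim σ') fun a => by
      rw [charpoly_lsmul_asModule_matrixRepresentation,
        charpoly_lsmul_asModule_matrixRepresentation,
        charpoly_groupAlgebraToMatrix_eq_of_tendsto hconv,
        charpoly_groupAlgebraToMatrix_eq_of_tendsto hconv']
  exact exists_conj_of_asModule_linearEquiv e
end

section
/- Let K be a nontrivially normed field which is a proper metric space (a local field), Γ a finitely generated group, n : ℕ, and ρ, ρ' : Γ →* GL_n(K) two group homomorphisms that are not separated by conjugation in the following sense: there exist a sequence of group homomorphisms ρ_k : Γ →* GL_n(K) and a sequence (g_k) in GL_n(K) such that for every γ ∈ Γ, ρ_k(γ) → ρ(γ) and g_k · ρ_k(γ) · g_k⁻¹ → ρ'(γ) entrywise. Then the closures of the conjugation orbits of ρ and ρ' intersect: there exists a group homomorphism σ : Γ →* GL_n(K) lying both in the closure of the conjugation orbit of ρ and in the closure of the conjugation orbit of ρ'. -/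
open Filter Topology

namespace Matrix

open scoped Pointwise

/-- The block upper unitriangular matrix with off-diagonal column `c`, as an invertible matrix. -/
def upperUnit {K m : Type*} [CommRing K] [Fintype m] [DecidableEq m] (c : m → K) :
    GL (m ⊕ Unit) K where
  val := fromBlocks 1 (replicateCol Unit c) 0 1
  inv := fromBlocks 1 (-replicateCol Unit c) 0 1
  val_inv := by simp [fromBlocks_multiply]
  inv_val := by simp [fromBlocks_multiply]

/-- The block lower unitriangular matrix with off-diagonal row `r`, as an invertible matrix. -/
def lowerUnit {K m : Type*} [CommRing K] [Fintype m] [DecidableEq m] (r : m → K) :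
    GL (m ⊕ Unit) K where
  val := fromBlocks 1 0 (replicateRow Unit r) 1
  inv := fromBlocks 1 0 (-replicateRow Unit r) 1
  val_inv := by simp [fromBlocks_multiply]
  inv_val := by simp [fromBlocks_multiply]

/-- The block diagonal matrix with blocks `u` and `1`, as an invertible matrix. -/
def blockUnit {K m : Type*} [CommRing K] [Fintype m] [DecidableEq m] (u : GL m K) :
    GL (m ⊕ Unit) K where
  val := fromBlocks u 0 0 1
  inv := fromBlocks (u⁻¹ : GL m K) 0 0 1
  val_inv := by simp [fromBlocks_multiply, -coe_units_inv]
  inv_val := by simp [fromBlocks_multiply, -coe_units_inv]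

section Continuity

variable {K m : Type*} [CommRing K] [TopologicalSpace K] [IsTopologicalRing K]
  [Fintype m] [DecidableEq m]

lemma continuous_upperUnit : Continuous (upperUnit : (m → K) → GL (m ⊕ Unit) K) := by
  have h : Continuous fun c : m → K => replicateCol Unit c :=
    continuous_matrix fun i _ => continuous_apply i
  exact Units.continuous_iff.2
    ⟨continuous_const.matrix_fromBlocks h continuous_const continuous_const,
      continuous_const.matrix_fromBlocks h.neg continuous_const continuous_const⟩

lemma continuous_lowerUnit : Continuous (lowerUnit : (m → K) → GL (m ⊕ Unit) K) := by
  have h : Continuous fun c : m → K => replicateRow Unit c :=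
    continuous_matrix fun _ i => continuous_apply i
  exact Units.continuous_iff.2
    ⟨continuous_const.matrix_fromBlocks continuous_const h continuous_const,
      continuous_const.matrix_fromBlocks continuous_const h.neg continuous_const⟩

end Continuity

lemma continuous_blockUnit {K m : Type*} [CommRing K] [TopologicalSpace K] [Fintype m]
    [DecidableEq m] : Continuous (blockUnit : GL m K → GL (m ⊕ Unit) K) :=
  Units.continuous_iff.2
    ⟨Units.continuous_val.matrix_fromBlocks continuous_const continuous_const continuous_const,
      Units.continuous_coe_inv.matrix_fromBlocks continuous_const continuous_const
        continuous_const⟩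


lemma swap_mul_mul_swap_apply {K m : Type*} [CommRing K] [Fintype m] [DecidableEq m]
    (M : Matrix m m K) (p q s i j : m) :
    (swap K p s * M * swap K q s) i j = M (Equiv.swap p s i) (Equiv.swap q s j) := by
  simp [swap, PEquiv.toMatrix_toPEquiv_mul, PEquiv.mul_toMatrix_toPEquiv]

/-- The matrices of size `m` can be diagonalized by multiplying on both sides by elements of
a compact set of invertible matrices. -/
def HasCompactDiagonalization (K m : Type*) [NontriviallyNormedField K] [Fintype m]
    [DecidableEq m] : Prop :=
  ∃ S : Set (GL m K), IsCompact S ∧ ∀ M : Matrix m m K, ∃ u ∈ S, ∃ v ∈ S, ∃ d : m → K,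
    (u : Matrix m m K) * M * (v : Matrix m m K) = diagonal d

variable {K : Type*} [NontriviallyNormedField K]

lemma HasCompactDiagonalization.reindex {m m' : Type*} [Fintype m] [DecidableEq m]
    [Fintype m'] [DecidableEq m'] (e : m ≃ m') (h : HasCompactDiagonalization K m) :
    HasCompactDiagonalization K m' := by
  obtain ⟨S, hS, H⟩ := h
  let f : Matrix m m K →* Matrix m' m' K := (reindexAlgEquiv K K e : _ →* _)
  have hf : Continuous f := continuous_id.matrix_reindex e e
  refine ⟨Units.map f '' S, hS.image (hf.units_map f), fun M => ?_⟩
  obtain ⟨u, hu, v, hv, d, hd⟩ := H (M.submatrix e e)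
  refine ⟨_, ⟨u, hu, rfl⟩, _, ⟨v, hv, rfl⟩, d ∘ e.symm, ?_⟩
  have hM : M = f (M.submatrix e e) := by ext; simp [f]
  rw [hM, Units.coe_map, Units.coe_map, ← map_mul, ← map_mul, hd]
  simp [f]

lemma HasCompactDiagonalization.sum_unit [ProperSpace K] {m : Type*} [Fintype m] [DecidableEq m]
    (h : HasCompactDiagonalization K m) : HasCompactDiagonalization K (m ⊕ Unit) := by
  obtain ⟨S, hS, H⟩ := h
  let B : Set (m → K) := Metric.closedBall 0 1
  have hB : IsCompact B := isCompact_closedBall 0 1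
  let P : Set (GL (m ⊕ Unit) K) :=
    Set.range fun p => GeneralLinearGroup.swap K p (Sum.inr ())
  have hP : IsCompact P := (Set.finite_range _).isCompact
  let S₁ := blockUnit '' S * upperUnit '' B * P
  let S₂ := P * lowerUnit '' B * blockUnit '' S
  have hS₁ : IsCompact S₁ :=
    ((hS.image continuous_blockUnit).mul (hB.image continuous_upperUnit)).mul hP
  have hS₂ : IsCompact S₂ :=
    (hP.mul (hB.image continuous_lowerUnit)).mul (hS.image continuous_blockUnit)
  refine ⟨S₁ ∪ S₂, hS₁.union hS₂, fun M => ?_⟩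
  obtain ⟨⟨p, q⟩, hpq⟩ := Finite.exists_max fun x : (m ⊕ Unit) × (m ⊕ Unit) => ‖M x.1 x.2‖
  let s : m ⊕ Unit := Sum.inr ()
  let N := swap K p s * M * swap K q s
  have hN : ∀ i j, ‖N i j‖ ≤ ‖N s s‖ := fun i j => by
    simpa [N, swap_mul_mul_swap_apply] using hpq (Equiv.swap p s i, Equiv.swap q s j)
  let x := N s s
  let c : m → K := fun i => N (Sum.inl i) s
  let r : m → K := fun j => N s (Sum.inl j)
  have key : ∀ y : K, ‖y‖ ≤ ‖x‖ → x * (-(x⁻¹ * y)) = -y ∧ ‖-(x⁻¹ * y)‖ ≤ 1 := by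
    intro y hy
    by_cases hx : x = 0
    · simp_all
    · refine ⟨by field_simp, ?_⟩
      rw [norm_neg, norm_mul, norm_inv, inv_mul_le_one₀ (norm_pos_iff.2 hx)]
      exact hy
  let c' : m → K := fun i => -(x⁻¹ * c i)
  let r' : m → K := fun i => -(x⁻¹ * r i)
  have hc' : c' ∈ B := by
    rw [mem_closedBall_zero_iff, pi_norm_le_iff_of_nonneg zero_le_one]
    exact fun i => (key _ (hN _ _)).2
  have hr' : r' ∈ B := by
    rw [mem_closedBall_zero_iff, pi_norm_le_iff_of_nonneg zero_le_one]
    exact fun i => (key _ (hN _ _)).2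
  have hxc : ∀ i, c i + c' i * x = 0 := fun i => by
    rw [mul_comm, (key (c i) (hN _ _)).1, add_neg_cancel]
  have hxr : ∀ i, r i + x * r' i = 0 := fun i => by
    rw [(key (r i) (hN _ _)).1, add_neg_cancel]
  let E : Matrix Unit Unit K := of fun _ _ => x
  have hblock : N = fromBlocks N.toBlocks₁₁ (replicateCol Unit c) (replicateRow Unit r)
      E := by
    ext (i | i) (j | j) <;> simp [toBlocks₁₁, c, r, x, s, E]
  let D := N.toBlocks₁₁ + replicateCol Unit c' * replicateRow Unit r
  have helim : (upperUnit c' : Matrix _ _ K) * N * (lowerUnit r' : Matrix _ _ K) =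
      fromBlocks D 0 0 E := by
    have h₁ : replicateCol Unit c + replicateCol Unit c' * E = 0 := by
      ext i j; simpa [mul_apply, E] using hxc i
    have h₂ : replicateRow Unit r + E * replicateRow Unit r' = 0 := by
      ext i j; simpa [mul_apply, E] using hxr j
    rw [hblock]
    simp [upperUnit, lowerUnit, fromBlocks_multiply, h₁, h₂, D]
  obtain ⟨u, hu, v, hv, d, hd⟩ := H D
  refine ⟨blockUnit u * upperUnit c' * GeneralLinearGroup.swap K p s,
    Or.inl (Set.mul_mem_mul (Set.mul_mem_mul ⟨u, hu, rfl⟩ ⟨c', hc', rfl⟩) ⟨p, rfl⟩),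
    GeneralLinearGroup.swap K q s * lowerUnit r' * blockUnit v,
    Or.inr (Set.mul_mem_mul (Set.mul_mem_mul ⟨q, rfl⟩ ⟨r', hr', rfl⟩) ⟨v, hv, rfl⟩),
    Sum.elim d fun _ => x, ?_⟩
  calc _ = (blockUnit u : Matrix _ _ K) *
        ((upperUnit c' : Matrix _ _ K) * N * (lowerUnit r' : Matrix _ _ K)) *
        (blockUnit v : Matrix _ _ K) := by
        simp only [Units.val_mul, GeneralLinearGroup.val_swap, N, Matrix.mul_assoc]
    _ = _ := by
        have hE : E = diagonal fun _ => x := by ext; simp [E]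
        rw [helim, ← fromBlocks_diagonal, ← hd, hE]
        simp [blockUnit, fromBlocks_multiply]

variable (K) in
lemma hasCompactDiagonalization_fin [ProperSpace K] (n : ℕ) :
    HasCompactDiagonalization K (Fin n) := by
  induction n with
  | zero => exact ⟨{1}, isCompact_singleton, fun M => ⟨1, rfl, 1, rfl, 0, Subsingleton.elim _ _⟩⟩
  | succ n ih =>
    exact ih.sum_unit.reindex
      ((Equiv.sumCongr (Equiv.refl _) finOneEquiv.symm).trans finSumFinEquiv)

/-- The diagonal matrix with invertible entries `a`, as an invertible matrix. -/
def diagonalUnit {R m : Type*} [CommRing R] [Fintype m] [DecidableEq m] (a : m → Rˣ) :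
    GL m R where
  val := diagonal fun i => (a i : R)
  inv := diagonal fun i => (((a i)⁻¹ : Rˣ) : R)
  val_inv := by simp
  inv_val := by simp

lemma diagonalUnit_conj_apply {R m : Type*} [CommRing R] [Fintype m] [DecidableEq m]
    (a : m → Rˣ) (M : Matrix m m R) (i j : m) :
    ((diagonalUnit a : Matrix m m R) * M * ((diagonalUnit a)⁻¹ : GL m R)) i j =
      M i j * (a i / a j : Rˣ) := by
  have : (((diagonalUnit a)⁻¹ : GL m R) : Matrix m m R) =
    diagonal fun i => (((a i)⁻¹ : Rˣ) : R) := rfl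
  rw [this, mul_diagonal]
  simp [diagonalUnit, div_eq_mul_inv]
  ring

variable (K) in
lemma exists_isCompact_mul_mul_eq_diagonalUnit [ProperSpace K] (n : ℕ) :
    ∃ S : Set (GL (Fin n) K), IsCompact S ∧ ∀ g : GL (Fin n) K, ∃ u ∈ S, ∃ v ∈ S,
      ∃ a : Fin n → Kˣ, u * g * v = diagonalUnit a := by
  obtain ⟨S, hS, H⟩ := hasCompactDiagonalization_fin K n
  refine ⟨S, hS, fun g => ?_⟩
  obtain ⟨u, hu, v, hv, d, hd⟩ := H g
  have hdet : IsUnit (diagonal d).det := by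
    rw [← hd]
    exact (isUnit_iff_isUnit_det _).1 (u * g * v).isUnit
  have hd0 : ∀ i, d i ≠ 0 := by
    simpa [det_diagonal, Finset.prod_ne_zero_iff] using hdet.ne_zero
  refine ⟨u, hu, v, hv, fun i => Units.mk0 (d i) (hd0 i), Units.ext ?_⟩
  simpa [diagonalUnit] using hd

end Matrix

lemma IsCompact.exists_tendsto_ultrafilter {α X : Type*} [TopologicalSpace X] {S : Set X}
    (hS : IsCompact S) (U : Ultrafilter α) {f : α → X} (hf : ∀ k, f k ∈ S) :
    ∃ x, Tendsto f U (𝓝 x) := by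
  obtain ⟨x, -, hx⟩ := hS.ultrafilter_le_nhds (U.map f)
    (tendsto_principal.2 (Eventually.of_forall hf))
  exact ⟨x, hx⟩

lemma Group.FG.countable {Γ : Type*} [Group Γ] [Group.FG Γ] : Countable Γ := by
  obtain ⟨α, _, φ, hφ⟩ := Group.fg_iff_exists_freeGroup_hom_surjective_finite.1 ‹Group.FG Γ›
  exact hφ.countable

section Units

variable {K : Type*} [NontriviallyNormedField K] {α : Type*}

lemma Units.tendsto_val_inv {l : Filter α} {r : α → Kˣ} {c : Kˣ}
    (h : Tendsto (fun k => (r k : K)) l (𝓝 c)) :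
    Tendsto (fun k => (((r k)⁻¹ : Kˣ) : K)) l (𝓝 ((c⁻¹ : Kˣ) : K)) := by
  simpa using h.inv₀ c.ne_zero

lemma Units.tendsto_ultrafilter_trichotomy [ProperSpace K] (U : Ultrafilter α) (r : α → Kˣ) :
    (∃ c : Kˣ, Tendsto (fun k => (r k : K)) U (𝓝 c)) ∨
      Tendsto (fun k => (r k : K)) U (𝓝 0) ∨
      Tendsto (fun k => (((r k)⁻¹ : Kˣ) : K)) U (𝓝 0) := by
  have bounded : ∀ s : α → Kˣ, (∀ᶠ k in U, ‖(s k : K)‖ ≤ 1) →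
      (∃ c : Kˣ, Tendsto (fun k => (s k : K)) U (𝓝 c)) ∨
        Tendsto (fun k => (s k : K)) U (𝓝 0) := by
    intro s hs
    obtain ⟨c, -, hc⟩ := (isCompact_closedBall (0 : K) 1).ultrafilter_le_nhds
      (U.map fun k => (s k : K)) (by
        simp only [Ultrafilter.coe_map, le_principal_iff, mem_map]
        filter_upwards [hs] with k hk
        simpa using hk)
    by_cases h0 : c = 0
    · exact Or.inr (h0 ▸ hc)
    · exact Or.inl ⟨Units.mk0 c h0, hc⟩
  rcases Ultrafilter.em U fun k => ‖(r k : K)‖ ≤ 1 with h | h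
  · exact (bounded r h).imp_right Or.inl
  · rcases bounded (fun k => (r k)⁻¹) (by
      filter_upwards [h] with k hk
      rw [Units.val_inv_eq_inv_val, norm_inv]
      exact inv_le_one_of_one_le₀ (not_le.1 hk).le) with ⟨c, hc⟩ | h'
    · exact Or.inl ⟨c⁻¹, by simpa using Units.tendsto_val_inv hc⟩
    · exact Or.inr (Or.inr h')

end Units

namespace Matrix

/-- If `P k → P'` and the conjugates of `P k` by diagonal matrices `a k` converge to `P''`, then
conjugating the limit `P'` by `a k`, and `P''` by `(a k)⁻¹` up to a fixed diagonal matrix `e`,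
yields a common limit. -/
lemma exists_common_limit_diagonalUnit {K : Type*} [NontriviallyNormedField K] [ProperSpace K]
    {α Γ m : Type*} [Fintype m] [DecidableEq m] (U : Ultrafilter α) (a : α → m → Kˣ)
    (P : α → Γ → Matrix m m K) (P' P'' : Γ → Matrix m m K)
    (h' : ∀ γ, Tendsto (fun k => P k γ) U (𝓝 (P' γ)))
    (h'' : ∀ γ, Tendsto (fun k => (diagonalUnit (a k) : Matrix m m K) * P k γ *
      ((diagonalUnit (a k))⁻¹ : GL m K)) U (𝓝 (P'' γ))) :
    ∃ (τ : Γ → Matrix m m K) (e : m → Kˣ),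
      (∀ γ, Tendsto (fun k => (diagonalUnit (a k) : Matrix m m K) * P' γ *
        ((diagonalUnit (a k))⁻¹ : GL m K)) U (𝓝 (τ γ))) ∧
      (∀ γ, Tendsto (fun k => (diagonalUnit (e / a k) : Matrix m m K) * P'' γ *
        ((diagonalUnit (e / a k))⁻¹ : GL m K)) U (𝓝 (τ γ))) := by
  classical
  have entry : ∀ (f : α → Matrix m m K) (M : Matrix m m K),
      Tendsto f U (𝓝 M) ↔ ∀ i j, Tendsto (fun k => f k i j) U (𝓝 (M i j)) := fun f M =>
    tendsto_pi_nhds.trans (forall_congr' fun i => tendsto_pi_nhds)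
  simp only [entry, diagonalUnit_conj_apply] at h' h'' ⊢
  let R : m → m → Prop := fun i j => ∃ c : Kˣ, Tendsto (fun k => ((a k i / a k j : Kˣ) : K)) U (𝓝 c)
  let s : Setoid m :=
    { r := R
      iseqv :=
        { refl := fun i => ⟨1, by simp⟩
          symm := fun {i j} ⟨c, hc⟩ => ⟨c⁻¹, by simpa using Units.tendsto_val_inv hc⟩
          trans := fun {i j l} ⟨c, hc⟩ ⟨d, hd⟩ => ⟨c * d, by
            simpa only [← Units.val_mul, div_mul_div_cancel] using hc.mul hd⟩ } }
  let rep : m → m := fun i => (Quotient.mk s i).out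
  have hrep : ∀ i, R i (rep i) := fun i => s.symm (Quotient.mk_out i)
  choose e he using hrep
  have hR : ∀ i j, R i j →
      Tendsto (fun k => ((a k i / a k j : Kˣ) : K)) U (𝓝 ((e i / e j : Kˣ) : K)) := by
    intro i j hij
    have hij' : rep i = rep j := congrArg Quotient.out (Quotient.sound (s := s) hij)
    have := (he i).mul (Units.tendsto_val_inv (he j))
    simpa only [← Units.val_mul, hij', inv_div, div_mul_div_cancel, ← div_eq_mul_inv] using this
  have hdiv : ∀ k i j, (e / a k) i / (e / a k) j = (a k i / a k j)⁻¹ * (e i / e j) :=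
    fun k i j => by
      simp only [Pi.div_apply, inv_div]
      rw [div_mul_div_comm, div_div_div_eq, mul_comm (a k j), mul_comm (a k i)]
  refine ⟨fun γ => of fun i j => if R i j then P'' γ i j else 0, e, fun γ i j => ?_,
    fun γ i j => ?_⟩
  all_goals
    have hP := h' γ i j
    have hP' := h'' γ i j
    simp only [of_apply]
    split_ifs with hij
  · rw [tendsto_nhds_unique hP' (hP.mul (hR i j hij))]
    exact (hR i j hij).const_mul _
  · rcases Units.tendsto_ultrafilter_trichotomy U fun k => a k i / a k j with h | h | h
    · exact absurd h hij
    · simpa using h.const_mul (P' γ i j)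
    · have := hP'.mul h
      simp only [mul_assoc, Units.mul_inv, mul_one, mul_zero] at this
      simp [tendsto_nhds_unique hP this]
  · have := ((Units.tendsto_val_inv (hR i j hij)).const_mul (P'' γ i j)).mul_const
      ((e i / e j : Kˣ) : K)
    rw [Units.inv_mul_cancel_right] at this
    exact this.congr fun k => by rw [mul_assoc, ← Units.val_mul, hdiv]
  · rcases Units.tendsto_ultrafilter_trichotomy U fun k => a k i / a k j with h | h | h
    · exact absurd h hij
    · simp [tendsto_nhds_unique hP' (by simpa using hP.mul h)]
    · have := (h.const_mul (P'' γ i j)).mul_const ((e i / e j : Kˣ) : K)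
      rw [mul_zero, zero_mul] at this
      exact this.congr fun k => by rw [mul_assoc, ← Units.val_mul, hdiv]

/-- A limit along a filter of conjugates of a representation of a countable group is a limit of
a sequence of conjugates. -/
lemma exists_seq_tendsto_conj {K : Type*} [NontriviallyNormedField K] {α Γ m : Type*}
    [Group Γ] [Countable Γ] [Fintype m] [DecidableEq m] {l : Filter α} [l.NeBot]
    (ρ : Γ →* GL m K) (τ : Γ → Matrix m m K) (h : α → GL m K)
    (H : ∀ γ, Tendsto (fun k => ((h k * ρ γ * (h k)⁻¹ : GL m K) : Matrix m m K)) l (𝓝 (τ γ))) :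
    ∃ h' : ℕ → GL m K, ∀ γ,
      Tendsto (fun k => ((h' k * ρ γ * (h' k)⁻¹ : GL m K) : Matrix m m K)) atTop (𝓝 (τ γ)) := by
  let F : GL m K → Γ → Matrix m m K := fun x γ => (x * ρ γ * x⁻¹ : GL m K)
  have : FirstCountableTopology (Matrix m m K) :=
    inferInstanceAs (FirstCountableTopology (m → m → K))
  have hτ : τ ∈ closure (Set.range F) :=
    mem_closure_of_tendsto (tendsto_pi_nhds.2 H) (Eventually.of_forall fun k => ⟨h k, rfl⟩)
  obtain ⟨x, hx, hlim⟩ := mem_closure_iff_seq_limit.1 hτ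
  choose h' hh' using hx
  refine ⟨h', fun γ => ?_⟩
  simpa only [← hh'] using tendsto_pi_nhds.1 hlim γ

/-- A pointwise limit of representations by matrices is a representation. -/
lemma exists_monoidHom_of_tendsto {K : Type*} [NontriviallyNormedField K] {α Γ m : Type*}
    [Group Γ] [Fintype m] [DecidableEq m] {l : Filter α} [l.NeBot]
    (ρ : α → Γ →* GL m K) (τ : Γ → Matrix m m K)
    (H : ∀ γ, Tendsto (fun k => (ρ k γ : Matrix m m K)) l (𝓝 (τ γ))) :
    ∃ σ : Γ →* GL m K, ∀ γ, (σ γ : Matrix m m K) = τ γ := by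
  let φ : Γ →* Matrix m m K :=
    { toFun := τ
      map_one' := tendsto_nhds_unique (H 1) (by simp)
      map_mul' := fun x y => tendsto_nhds_unique (H (x * y)) (by
        simpa only [map_mul, Units.val_mul] using (H x).mul (H y)) }
  exact ⟨φ.toHomUnits, fun γ => rfl⟩

end Matrix

/-- Over a local field, if two representations `ρ, ρ'` of a finitely generated
group are not separated by conjugation (there are homomorphisms `ρ_k → ρ` with
`g_k ρ_k g_k⁻¹ → ρ'`), then the closures of their conjugation orbits intersect: some
homomorphism `σ` is a limit of conjugates of `ρ` and also a limit of conjugates of `ρ'`. -/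
theorem stmt16 {K : Type*} [NontriviallyNormedField K] [ProperSpace K]
    {Γ : Type*} [Group Γ] [Group.FG Γ] {n : ℕ}
    (ρ ρ' : Γ →* Matrix.GeneralLinearGroup (Fin n) K)
    (ρseq : ℕ → (Γ →* Matrix.GeneralLinearGroup (Fin n) K))
    (g : ℕ → Matrix.GeneralLinearGroup (Fin n) K)
    (hconv : ∀ γ : Γ,
      Tendsto (fun k : ℕ => ((ρseq k γ : Matrix (Fin n) (Fin n) K)))
        atTop (nhds ((ρ γ : Matrix (Fin n) (Fin n) K))))
    (hconv' : ∀ γ : Γ,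
      Tendsto
        (fun k : ℕ =>
          ((g k * ρseq k γ * (g k)⁻¹ : Matrix.GeneralLinearGroup (Fin n) K) :
            Matrix (Fin n) (Fin n) K))
        atTop (nhds ((ρ' γ : Matrix (Fin n) (Fin n) K)))) :
    ∃ σ : Γ →* Matrix.GeneralLinearGroup (Fin n) K,
      (∃ h : ℕ → Matrix.GeneralLinearGroup (Fin n) K,
        ∀ γ : Γ,
          Tendsto
            (fun k : ℕ =>
              ((h k * ρ γ * (h k)⁻¹ : Matrix.GeneralLinearGroup (Fin n) K) :
                Matrix (Fin n) (Fin n) K))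
            atTop (nhds ((σ γ : Matrix (Fin n) (Fin n) K)))) ∧
      (∃ h' : ℕ → Matrix.GeneralLinearGroup (Fin n) K,
        ∀ γ : Γ,
          Tendsto
            (fun k : ℕ =>
              ((h' k * ρ' γ * (h' k)⁻¹ : Matrix.GeneralLinearGroup (Fin n) K) :
                Matrix (Fin n) (Fin n) K))
            atTop (nhds ((σ γ : Matrix (Fin n) (Fin n) K)))) := by
  have := Group.FG.countable (Γ := Γ)
  let U : Ultrafilter ℕ := hyperfilter ℕ
  have hU : (U : Filter ℕ) ≤ atTop := Nat.hyperfilter_le_atTop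
  obtain ⟨S, hS, HS⟩ := Matrix.exists_isCompact_mul_mul_eq_diagonalUnit K n
  choose u hu v hv a ha using fun k => HS (g k)
  obtain ⟨u₀, hu₀⟩ := hS.exists_tendsto_ultrafilter U hu
  obtain ⟨v₀, hv₀⟩ := hS.exists_tendsto_ultrafilter U hv
  have conj : ∀ {x : ℕ → GL (Fin n) K} {x₀ : GL (Fin n) K} {M : ℕ → Matrix (Fin n) (Fin n) K}
      {M₀ : Matrix (Fin n) (Fin n) K}, Tendsto x U (𝓝 x₀) → Tendsto M U (𝓝 M₀) →
      Tendsto (fun k => (x k : Matrix (Fin n) (Fin n) K) * M k * ((x k)⁻¹ : GL (Fin n) K)) U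
        (𝓝 ((x₀ : Matrix (Fin n) (Fin n) K) * M₀ * (x₀⁻¹ : GL (Fin n) K))) := fun hx hM =>
    (((Units.continuous_val.tendsto _).comp hx).mul hM).mul
      ((Units.continuous_val.tendsto _).comp hx.inv)
  obtain ⟨τ, e, h₁, h₂⟩ := Matrix.exists_common_limit_diagonalUnit U a
    (fun k γ => ((v k)⁻¹ * ρseq k γ * (v k)⁻¹⁻¹ : GL (Fin n) K))
    (fun γ => (v₀⁻¹ * ρ γ * v₀⁻¹⁻¹ : GL (Fin n) K))
    (fun γ => (u₀ * ρ' γ * u₀⁻¹ : GL (Fin n) K))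
    (fun γ => by
      simpa only [Units.val_mul] using conj hv₀.inv ((hconv γ).mono_left hU))
    (fun γ => by
      simp only [← Units.val_mul]
      refine (conj hu₀ ((hconv' γ).mono_left hU)).congr fun k => ?_
      simp only [← Units.val_mul, ← ha]
      congr 1
      group)
  have h₁' : ∀ γ, Tendsto (fun k => (((Matrix.diagonalUnit (a k) * v₀⁻¹) * ρ γ *
      (Matrix.diagonalUnit (a k) * v₀⁻¹)⁻¹ : GL (Fin n) K) : Matrix (Fin n) (Fin n) K)) U
      (𝓝 (τ γ)) := fun γ => by
    simpa only [← Units.val_mul, mul_inv_rev, mul_assoc] using h₁ γ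
  have h₂' : ∀ γ, Tendsto (fun k => (((Matrix.diagonalUnit (e / a k) * u₀) * ρ' γ *
      (Matrix.diagonalUnit (e / a k) * u₀)⁻¹ : GL (Fin n) K) : Matrix (Fin n) (Fin n) K)) U
      (𝓝 (τ γ)) := fun γ => by
    simpa only [← Units.val_mul, mul_inv_rev, mul_assoc] using h₂ γ
  obtain ⟨σ, hσ⟩ := Matrix.exists_monoidHom_of_tendsto
    (fun k => (MulAut.conj (Matrix.diagonalUnit (a k) * v₀⁻¹)).toMonoidHom.comp ρ) τ h₁'
  refine ⟨σ, ?_, ?_⟩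
  · simp only [hσ]
    exact Matrix.exists_seq_tendsto_conj ρ τ _ h₁'
  · simp only [hσ]
    exact Matrix.exists_seq_tendsto_conj ρ' τ _ h₂'
end

section
/- Let K be a nontrivially normed field which is a proper metric space (a local field), Γ a finitely generated group, and n : ℕ. Let R_ss be the set of semisimple group homomorphisms ρ : Γ →* GL_n(K), equipped with the topology of pointwise convergence (the topology induced by the injection ρ ↦ (γ ↦ ρ(γ)) into the product space Γ → M_n(K)). Then the quotient topological space of R_ss by the equivalence relation 'ρ ~ ρ' iff there exists g ∈ GL_n(K) with ρ'(γ) = g ρ(γ) g⁻¹ for all γ ∈ Γ' is Hausdorff. -/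
open Filter Topology
open scoped Matrix

open scoped MonoidAlgebra

/-- If two multiplicative maps on a monoid algebra agree at all `1 + t • single g c` for a fixed
nilpotent scalar `t`, then they agree at all `1 + t • a`. -/
theorem map_one_add_smul_eq_of_isNilpotent {R G M : Type*} [CommRing R] [Monoid G] [CommMonoid M]
    (D D' : MonoidAlgebra R G →* M) {t : R} (ht : IsNilpotent t)
    (h : ∀ (g : G) (c : R), D (1 + t • MonoidAlgebra.single g c) =
      D' (1 + t • MonoidAlgebra.single g c)) (a : MonoidAlgebra R G) :
    D (1 + t • a) = D' (1 + t • a) := by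
  obtain ⟨N, hN⟩ := ht
  suffices H : ∀ k d, N ≤ d + k → ∀ a : MonoidAlgebra R G,
      D (1 + t ^ (d + 1) • a) = D' (1 + t ^ (d + 1) • a) by
    simpa using H N 0 (by omega) a
  intro k
  induction k with
  | zero =>
    intro d hd a
    have : t ^ (d + 1) = 0 := pow_eq_zero_of_le (by omega) hN
    simp [this]
  | succ k ih =>
    intro d hd a
    suffices H : ∀ y, D (1 + t ^ (d + 1) • a + t ^ (d + 2) • y) =
        D' (1 + t ^ (d + 1) • a + t ^ (d + 2) • y) by simpa using H 0
    induction a using MonoidAlgebra.induction with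
    | zero => intro y; simpa using ih (d + 1) (by omega) y
    | single_add g c x _ _ hx =>
      intro y
      set s := t ^ (d + 1) • MonoidAlgebra.single g c with hs
      have hnil : IsNilpotent s := by
        refine ⟨N, ?_⟩
        rw [hs, smul_pow, ← pow_mul, mul_comm, pow_mul, hN, zero_pow (by omega), zero_smul]
      obtain ⟨u, hu⟩ := hnil.isUnit_one_add
      set v : MonoidAlgebra R G := ((u⁻¹ : (MonoidAlgebra R G)ˣ) : MonoidAlgebra R G)
      have huv : (1 + s) * v = 1 := by rw [← hu]; exact u.mul_inv
      have hv : v = 1 - t ^ (d + 1) • (MonoidAlgebra.single g c * v) := by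
        rw [← smul_mul_assoc, ← hs, eq_sub_iff_add_eq, ← huv]; noncomm_ring
      have key : 1 + t ^ (d + 1) • (MonoidAlgebra.single g c + x) + t ^ (d + 2) • y =
          (1 + s) * (1 + t ^ (d + 1) • x +
            t ^ (d + 2) • (v * y - t ^ d • (MonoidAlgebra.single g c * v * x))) := by
        have h1 : 1 + t ^ (d + 1) • x +
            t ^ (d + 2) • (v * y - t ^ d • (MonoidAlgebra.single g c * v * x)) =
            1 + v * (t ^ (d + 1) • x + t ^ (d + 2) • y) := by
          have h2 : v * x = x - t ^ (d + 1) • (MonoidAlgebra.single g c * v * x) := by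
            conv_lhs => rw [hv]
            rw [sub_mul, one_mul, smul_mul_assoc]
          rw [mul_add, mul_smul_comm, mul_smul_comm, h2]
          module
        rw [h1, mul_add, ← mul_assoc, huv, smul_add, ← hs]
        noncomm_ring
      have hs' : D (1 + s) = D' (1 + s) := by
        have := h g (t ^ d * c)
        rwa [← smul_eq_mul, ← MonoidAlgebra.smul_single, smul_smul, ← pow_succ'] at this
      rw [key, map_mul, map_mul, hs', hx]

theorem eval₂_charpolyRev {R S ι : Type*} [CommRing R] [CommRing S] [Fintype ι] [DecidableEq ι]
    (f : R →+* S) (s : S) (M : Matrix ι ι R) :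
    M.charpolyRev.eval₂ f s = (1 - s • M.map f).det := by
  rw [Matrix.charpolyRev, ← Polynomial.coe_eval₂RingHom, RingHom.map_det]
  congr 1
  ext i j
  simp [Matrix.one_apply, apply_ite]
  exact mul_comm _ _

/-- Matrix representations `ρ` and `ρ'` of a monoid such that `ρ g` and `ρ' g` always have the same
characteristic polynomial cannot be separated by an element of the monoid algebra acting as the
identity through `ρ` and as zero through `ρ'`, unless `ρ` has degree zero. -/
theorem isEmpty_of_charpoly_eq_of_lift {K G ι ι' : Type*} [Field K] [Monoid G] [Fintype ι]
    [DecidableEq ι] [Fintype ι'] [DecidableEq ι'] (ρ : G →* Matrix ι ι K) (ρ' : G →* Matrix ι' ι' K)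
    (h : ∀ g, (ρ g).charpoly = (ρ' g).charpoly) (a : MonoidAlgebra K G)
    (ha : MonoidAlgebra.lift K _ G ρ a = 1) (ha' : MonoidAlgebra.lift K _ G ρ' a = 0) :
    IsEmpty ι := by
  classical
  let I : Ideal (Polynomial K) := Ideal.span {Polynomial.X ^ (Fintype.card ι + 1)}
  let R := Polynomial K ⧸ I
  let t : R := Ideal.Quotient.mk I Polynomial.X
  have ht : IsNilpotent t := by
    refine ⟨Fintype.card ι + 1, ?_⟩
    rw [← map_pow, Ideal.Quotient.eq_zero_iff_mem]
    exact Ideal.mem_span_singleton_self _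
  let f : K →+* R := algebraMap K R
  let L : MonoidAlgebra R G →ₐ[R] Matrix ι ι R :=
    MonoidAlgebra.lift R _ G ((f.mapMatrix (m := ι)).toMonoidHom.comp ρ)
  let L' : MonoidAlgebra R G →ₐ[R] Matrix ι' ι' R :=
    MonoidAlgebra.lift R _ G ((f.mapMatrix (m := ι')).toMonoidHom.comp ρ')
  have hL : ∀ x, L (MonoidAlgebra.mapRingHom G f x) =
      f.mapMatrix (MonoidAlgebra.lift K _ G ρ x) := by
    intro x
    induction x using MonoidAlgebra.induction_linear with
    | zero => simp
    | add x y hx hy => simp only [map_add, hx, hy]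
    | single g c =>
      ext i j
      simp [L]
  have hL' : ∀ x, L' (MonoidAlgebra.mapRingHom G f x) =
      f.mapMatrix (MonoidAlgebra.lift K _ G ρ' x) := by
    intro x
    induction x using MonoidAlgebra.induction_linear with
    | zero => simp
    | add x y hx hy => simp only [map_add, hx, hy]
    | single g c =>
      ext i j
      simp [L']
  have key := map_one_add_smul_eq_of_isNilpotent
    ((Matrix.detMonoidHom (R := R)).comp (L : MonoidAlgebra R G →* Matrix ι ι R))
    ((Matrix.detMonoidHom (R := R)).comp (L' : MonoidAlgebra R G →* Matrix ι' ι' R)) ht (by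
      intro g c
      have e := congrArg (fun p : Polynomial K => p.reverse.eval₂ f (-(t * c))) (h g)
      simp only [Matrix.reverse_charpoly, eval₂_charpolyRev, neg_smul, sub_neg_eq_add] at e
      simpa [L, L', smul_smul] using! e) (MonoidAlgebra.mapRingHom G f a)
  have key2 : (1 + t) ^ Fintype.card ι = 1 := by
    have e1 : (1 : Matrix ι ι R) + t • 1 = (1 + t) • 1 := by module
    simpa [hL, hL', ha, ha', e1, Matrix.det_smul] using key
  have hdvd : Polynomial.X ^ (Fintype.card ι + 1) ∣
      ((1 + Polynomial.X) ^ Fintype.card ι - 1 : Polynomial K) := by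
    rw [← Ideal.mem_span_singleton, ← Ideal.Quotient.eq_zero_iff_mem, map_sub, map_pow, map_add,
      map_one]
    exact sub_eq_zero.mpr key2
  have hdeg : ((1 + Polynomial.X : Polynomial K) ^ Fintype.card ι).natDegree = Fintype.card ι := by
    rw [add_comm, ← Polynomial.C_1, Polynomial.natDegree_pow, Polynomial.natDegree_X_add_C, mul_one]
  have hzero := Polynomial.eq_zero_of_dvd_of_natDegree_lt hdvd (by
    rw [Polynomial.natDegree_X_pow]
    refine lt_of_le_of_lt (Polynomial.natDegree_sub_le _ _) ?_
    rw [hdeg]; simp)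
  rw [sub_eq_zero.mp hzero, Polynomial.natDegree_one] at hdeg
  exact Fintype.card_eq_zero_iff.mp hdeg.symm

instance IsSemisimpleModule.prod {R M N : Type*} [Ring R] [AddCommGroup M] [AddCommGroup N]
    [Module R M] [Module R N] [IsSemisimpleModule R M] [IsSemisimpleModule R N] :
    IsSemisimpleModule R (M × N) := by
  have : IsSemisimpleModule R
      (LinearMap.range (LinearMap.inl R M N) ⊔ LinearMap.range (LinearMap.inr R M N) :
        Submodule R (M × N)) :=
    IsSemisimpleModule.sup (.range _) (.range _)
  rw [LinearMap.sup_range_inl_inr] at this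
  exact .congr (Submodule.topEquiv (R := R) (M := M × N)).symm

/-- Two semisimple modules without nonzero homomorphisms between them can be separated on finite
sets by a scalar. -/
theorem exists_smul_eq_self_and_smul_eq_zero_s18 {R M N : Type*} [Ring R] [AddCommGroup M]
    [AddCommGroup N] [Module R M] [Module R N] [IsSemisimpleModule R M] [IsSemisimpleModule R N]
    (h : ∀ f : M →ₗ[R] N, f = 0) (h' : ∀ f : N →ₗ[R] M, f = 0) (s : Finset M) (s' : Finset N) :
    ∃ r : R, (∀ m ∈ s, r • m = m) ∧ ∀ m ∈ s', r • m = 0 := by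
  classical
  let p : Module.End (Module.End R (M × N)) (M × N) :=
    { toFun := fun x => (x.1, 0)
      map_add' := fun x y => by simp
      map_smul' := fun φ x => by
        have e1 : (φ (x.1, 0)).2 = 0 :=
          congr($(h (LinearMap.snd R M N ∘ₗ φ ∘ₗ LinearMap.inl R M N)) x.1)
        have e2 : (φ (0, x.2)).1 = 0 :=
          congr($(h' (LinearMap.fst R M N ∘ₗ φ ∘ₗ LinearMap.inr R M N)) x.2)
        have e3 : φ x = φ (x.1, 0) + φ (0, x.2) := by rw [← map_add]; simp
        ext <;> simp [e1, e2, e3] }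
  obtain ⟨r, hr⟩ := jacobson_density p (s.image (fun m => (m, 0)) ∪ s'.image (fun m => (0, m)))
  refine ⟨r, fun m hm => ?_, fun m hm => ?_⟩
  · have := hr (m, 0) (by simp [hm])
    exact congr($(this).1).symm
  · have := hr (0, m) (by simp [hm])
    exact congr($(this).2).symm

theorem exists_simple_submodule_linearEquiv {R M N : Type*} [Ring R] [AddCommGroup M]
    [AddCommGroup N] [Module R M] [Module R N] [IsSemisimpleModule R M] {f : M →ₗ[R] N}
    (hf : f ≠ 0) :
    ∃ (S : Submodule R M) (S' : Submodule R N), IsSimpleModule R S ∧ Nonempty (S ≃ₗ[R] S') := by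
  obtain ⟨S, hS : IsSimpleModule R S, ne⟩ :=
    LinearMap.exists_ne_zero_of_sSup_eq_top hf _ (IsSemisimpleModule.sSup_simples_eq_top R M)
  exact ⟨S, _, hS, ⟨.ofInjective _ (LinearMap.injective_of_ne_zero ne)⟩⟩

theorem isEmpty_of_charpoly_eq_of_algHom {K G ι ι' : Type*} [Field K] [Monoid G] [Fintype ι]
    [DecidableEq ι] [Fintype ι'] [DecidableEq ι'] (L : K[G] →ₐ[K] Matrix ι ι K)
    (L' : K[G] →ₐ[K] Matrix ι' ι' K)
    (h : ∀ g, (L (MonoidAlgebra.of K G g)).charpoly = (L' (MonoidAlgebra.of K G g)).charpoly)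
    (a : K[G]) (ha : L a = 1) (ha' : L' a = 0) : IsEmpty ι := by
  obtain ⟨ρ, rfl⟩ := (MonoidAlgebra.lift K (Matrix ι ι K) G).surjective L
  obtain ⟨ρ', rfl⟩ := (MonoidAlgebra.lift K (Matrix ι' ι' K) G).surjective L'
  simp only [MonoidAlgebra.lift_of] at h
  exact isEmpty_of_charpoly_eq_of_lift ρ ρ' h a ha ha'

theorem charpoly_lsmul_congr {K A V W : Type*} [Field K] [Ring A] [Algebra K A] [AddCommGroup V]
    [Module K V] [Module A V] [IsScalarTower K A V] [Module.Finite K V] [AddCommGroup W]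
    [Module K W] [Module A W] [IsScalarTower K A W] [Module.Finite K W] (e : V ≃ₗ[A] W) (a : A) :
    (Algebra.lsmul K K V a).charpoly = (Algebra.lsmul K K W a).charpoly := by
  rw [← (e.restrictScalars K).charpoly_conj]
  congr 1
  ext w
  simp [LinearEquiv.conj_apply]

theorem charpoly_lsmul_prod {K A V W : Type*} [Field K] [Ring A] [Algebra K A] [AddCommGroup V]
    [Module K V] [Module A V] [IsScalarTower K A V] [Module.Finite K V] [AddCommGroup W]
    [Module K W] [Module A W] [IsScalarTower K A W] [Module.Finite K W] (a : A) :
    (Algebra.lsmul K K (V × W) a).charpoly =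
      (Algebra.lsmul K K V a).charpoly * (Algebra.lsmul K K W a).charpoly := by
  rw [← LinearMap.charpoly_prodMap]
  rfl

section

variable {K G : Type*} [Field K] [Group G]

theorem subsingleton_of_charpoly_eq {V W : Type*} [AddCommGroup V] [AddCommGroup W]
    [Module K V] [Module K W] [Module K[G] V] [Module K[G] W] [IsScalarTower K K[G] V]
    [IsScalarTower K K[G] W] [Module.Finite K V] [Module.Finite K W]
    [IsSemisimpleModule K[G] V] [IsSemisimpleModule K[G] W]
    (h : ∀ f : V →ₗ[K[G]] W, f = 0) (h' : ∀ f : W →ₗ[K[G]] V, f = 0)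
    (hc : ∀ g : G, (Algebra.lsmul K K V (MonoidAlgebra.of K G g)).charpoly =
      (Algebra.lsmul K K W (MonoidAlgebra.of K G g)).charpoly) : Subsingleton V := by
  classical
  let b := Module.finBasis K V
  let b' := Module.finBasis K W
  obtain ⟨a, ha, ha'⟩ := exists_smul_eq_self_and_smul_eq_zero_s18 h h'
    (Finset.univ.image b) (Finset.univ.image b')
  have e1 : Algebra.lsmul K K V a = 1 := b.ext fun i => by simpa using ha (b i) (by simp)
  have e2 : Algebra.lsmul K K W a = 0 := b'.ext fun i => by simpa using ha' (b' i) (by simp)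
  have hempty := isEmpty_of_charpoly_eq_of_algHom
    ((LinearMap.toMatrixAlgEquiv b).toAlgHom.comp (Algebra.lsmul K K V))
    ((LinearMap.toMatrixAlgEquiv b').toAlgHom.comp (Algebra.lsmul K K W))
    (fun g => (LinearMap.charpoly_toMatrix _ b).trans
      ((hc g).trans (LinearMap.charpoly_toMatrix _ b').symm)) a
    ((congrArg (LinearMap.toMatrixAlgEquiv b) e1).trans (map_one _))
    ((congrArg (LinearMap.toMatrixAlgEquiv b') e2).trans (map_zero _))
  rw [← Module.finrank_eq_zero_iff_of_free (R := K), ← Fintype.card_fin (Module.finrank K V)]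
  exact Fintype.card_eq_zero

/-- The **Brauer–Nesbitt theorem**: finite-dimensional semisimple representations of a group over
an arbitrary field are isomorphic as soon as every group element has the same characteristic
polynomial on both. -/
theorem nonempty_linearEquiv_of_charpoly_eq {V W : Type*} [AddCommGroup V] [AddCommGroup W]
    [Module K V] [Module K W] [Module K[G] V] [Module K[G] W] [IsScalarTower K K[G] V]
    [IsScalarTower K K[G] W] [Module.Finite K V] [Module.Finite K W]
    [IsSemisimpleModule K[G] V] [IsSemisimpleModule K[G] W]
    (hc : ∀ g : G, (Algebra.lsmul K K V (MonoidAlgebra.of K G g)).charpoly =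
      (Algebra.lsmul K K W (MonoidAlgebra.of K G g)).charpoly) : Nonempty (V ≃ₗ[K[G]] W) := by
  induction hn : Module.finrank K V using Nat.strong_induction_on generalizing V W with
  | _ n ih =>
  by_cases H : ∃ (S : Submodule K[G] V) (S' : Submodule K[G] W),
      IsSimpleModule K[G] S ∧ Nonempty (S ≃ₗ[K[G]] S')
  · obtain ⟨S, S', hS, ⟨e⟩⟩ := H
    obtain ⟨T, hT⟩ := exists_isCompl S
    obtain ⟨T', hT'⟩ := exists_isCompl S'
    have f := Submodule.prodEquivOfIsCompl S T hT
    have f' := Submodule.prodEquivOfIsCompl S' T' hT'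
    have fin (P : Submodule K[G] V) : Module.Finite K P :=
      inferInstanceAs (Module.Finite K (P.restrictScalars K))
    have fin' (P : Submodule K[G] W) : Module.Finite K P :=
      inferInstanceAs (Module.Finite K (P.restrictScalars K))
    have hS0 := IsSimpleModule.nontrivial K[G] S
    have hlt : Module.finrank K T < n := by
      have h1 := (f.restrictScalars K).finrank_eq
      rw [Module.finrank_prod] at h1
      have h2 := Module.finrank_pos (R := K) (M := S)
      omega
    obtain ⟨k⟩ := ih _ hlt (V := T) (W := T') (fun g => by
      have h := hc g
      rw [← charpoly_lsmul_congr f, ← charpoly_lsmul_congr f', charpoly_lsmul_prod,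
        charpoly_lsmul_prod, charpoly_lsmul_congr e] at h
      exact mul_left_cancel₀ (LinearMap.charpoly_monic _).ne_zero h) rfl
    exact ⟨f.symm.trans ((e.prodCongr k).trans f')⟩
  · have h : ∀ f : V →ₗ[K[G]] W, f = 0 := fun f => by
      by_contra hf
      exact H (exists_simple_submodule_linearEquiv hf)
    have h' : ∀ f : W →ₗ[K[G]] V, f = 0 := fun f => by
      by_contra hf
      obtain ⟨S, S', hS, ⟨e⟩⟩ := exists_simple_submodule_linearEquiv hf
      exact H ⟨S', S, .congr e.symm, ⟨e.symm⟩⟩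
    have := subsingleton_of_charpoly_eq h h' hc
    have := subsingleton_of_charpoly_eq h' h fun g => (hc g).symm
    exact ⟨LinearEquiv.ofSubsingleton V W⟩

end

/-- The linear representation on `K^n` given by matrix-vector multiplication through `ρ`. -/
def mulVecRep {K Γ : Type*} [Field K] [Group Γ] {n : ℕ}
    (ρ : Γ →* Matrix.GeneralLinearGroup (Fin n) K) : Representation K Γ (Fin n → K) :=
  (Matrix.toLinAlgEquiv' (R := K) (n := Fin n) : Matrix (Fin n) (Fin n) K →* _).comp
    ((Units.coeHom _).comp ρ)

section

variable {K Γ : Type*} [Field K] [Group Γ] {n : ℕ} {ρ ρ' : Γ →* Matrix.GeneralLinearGroup (Fin n) K}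

theorem mulVecRep_apply (γ : Γ) (v : Fin n → K) :
    mulVecRep ρ γ v = (ρ γ : Matrix (Fin n) (Fin n) K) *ᵥ v := rfl

theorem IsSemisimpleRep.isSemisimpleModule_s18 (h : IsSemisimpleRep ρ) :
    IsSemisimpleModule K[Γ] (mulVecRep ρ).asModule := by
  rw [← Representation.isSemisimpleRepresentation_iff_isSemisimpleModule_asModule]
  refine ⟨fun W => ?_⟩
  obtain ⟨W', hW', hc⟩ := h W.toSubmodule fun γ w hw => W.apply_mem_toSubmodule γ hw
  refine ⟨⟨W', fun γ w hw => hW' γ w hw⟩, ?_⟩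
  rw [isCompl_iff, disjoint_iff, codisjoint_iff] at hc ⊢
  exact ⟨Subrepresentation.toSubmodule_injective hc.1,
    Subrepresentation.toSubmodule_injective hc.2⟩

theorem charpoly_lsmul_mulVecRep (γ : Γ) :
    (Algebra.lsmul K K (mulVecRep ρ).asModule (MonoidAlgebra.of K Γ γ)).charpoly =
      (ρ γ : Matrix (Fin n) (Fin n) K).charpoly := by
  rw [← (mulVecRep ρ).asModuleEquiv.charpoly_conj, ← Matrix.charpoly_toLin']
  congr 1
  refine LinearMap.ext fun v => ?_
  rw [LinearEquiv.conj_apply_apply, Matrix.toLin'_apply, ← mulVecRep_apply]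
  change (mulVecRep ρ).asModuleEquiv
    (MonoidAlgebra.of K Γ γ • (mulVecRep ρ).asModuleEquiv.symm v) = mulVecRep ρ γ v
  rw [← Representation.asModuleEquiv_symm_map_rho, LinearEquiv.apply_symm_apply]

theorem IsSemisimpleRep.exists_conj_of_charpoly_eq (h : IsSemisimpleRep ρ)
    (h' : IsSemisimpleRep ρ') (hc : ∀ γ, (ρ γ : Matrix (Fin n) (Fin n) K).charpoly =
      (ρ' γ : Matrix (Fin n) (Fin n) K).charpoly) :
    ∃ g : Matrix.GeneralLinearGroup (Fin n) K, ∀ γ, ρ' γ = g * ρ γ * g⁻¹ := by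
  have := h.isSemisimpleModule_s18
  have := h'.isSemisimpleModule_s18
  obtain ⟨e⟩ := nonempty_linearEquiv_of_charpoly_eq (K := K) (G := Γ)
    (V := (mulVecRep ρ).asModule) (W := (mulVecRep ρ').asModule) fun γ => by
      rw [charpoly_lsmul_mulVecRep, charpoly_lsmul_mulVecRep, hc]
  let f : (Fin n → K) ≃ₗ[K] (Fin n → K) := (mulVecRep ρ).asModuleEquiv.symm.trans
    ((e.restrictScalars K).trans (mulVecRep ρ').asModuleEquiv)
  have hf (γ : Γ) (v : Fin n → K) : f ((ρ γ : Matrix (Fin n) (Fin n) K) *ᵥ v) =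
      (ρ' γ : Matrix (Fin n) (Fin n) K) *ᵥ f v := by
    simp only [← mulVecRep_apply, f, LinearEquiv.trans_apply, LinearEquiv.restrictScalars_apply,
      Representation.asModuleEquiv_symm_map_rho, map_smul, Representation.asModuleEquiv_map_smul,
      MonoidAlgebra.of_apply, Representation.asAlgebraHom_single, one_smul]
  let g : Matrix.GeneralLinearGroup (Fin n) K :=
    Matrix.GeneralLinearGroup.toLin.symm (LinearMap.GeneralLinearGroup.ofLinearEquiv f)
  have hg (v : Fin n → K) : (g : Matrix (Fin n) (Fin n) K) *ᵥ v = f v := by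
    rw [← Matrix.toLin'_apply]
    have : Matrix.GeneralLinearGroup.toLin g = LinearMap.GeneralLinearGroup.ofLinearEquiv f :=
      Matrix.GeneralLinearGroup.toLin.apply_symm_apply _
    exact congr(($this : Module.End K (Fin n → K)) v)
  refine ⟨g, fun γ => eq_mul_inv_of_mul_eq (Units.ext ?_)⟩
  refine Matrix.toLin'.injective (LinearMap.ext fun v => ?_)
  simp only [Matrix.toLin'_apply, Units.val_mul, ← Matrix.mulVec_mulVec, hg, hf]

end

/-- Over a local field `K` and for a finitely generated group `Γ`, the
quotient of the space of semisimple representations `Γ →* GL_n(K)` (with the topology of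
pointwise convergence, induced from the product space `Γ → M_n(K)`) by the conjugation
equivalence is Hausdorff. -/
theorem stmt18 {K : Type*} [NontriviallyNormedField K] [ProperSpace K]
    {Γ : Type*} [Group Γ] [Group.FG Γ] {n : ℕ} :
    letI : TopologicalSpace (Γ →* Matrix.GeneralLinearGroup (Fin n) K) :=
      TopologicalSpace.induced
        (fun ρ : Γ →* Matrix.GeneralLinearGroup (Fin n) K =>
          (fun γ : Γ => ((ρ γ : Matrix (Fin n) (Fin n) K))))
        inferInstance
    T2Space (Quot (fun ρ ρ' :
        {ρ : Γ →* Matrix.GeneralLinearGroup (Fin n) K // IsSemisimpleRep ρ} =>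
      ∃ g : Matrix.GeneralLinearGroup (Fin n) K, ∀ γ : Γ, ρ'.1 γ = g * ρ.1 γ * g⁻¹)) := by
  let _ : TopologicalSpace (Γ →* Matrix.GeneralLinearGroup (Fin n) K) :=
    TopologicalSpace.induced (fun ρ γ => (ρ γ : Matrix (Fin n) (Fin n) K)) inferInstance
  let F : {ρ : Γ →* Matrix.GeneralLinearGroup (Fin n) K // IsSemisimpleRep ρ} → Γ → K → K :=
    fun ρ γ x => (ρ.1 γ : Matrix (Fin n) (Fin n) K).charpoly.eval x
  have hF : Continuous F := by
    have hcoe : Continuous fun ρ : Γ →* Matrix.GeneralLinearGroup (Fin n) K =>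
        (fun γ : Γ => ((ρ γ : Matrix (Fin n) (Fin n) K))) := continuous_induced_dom
    refine continuous_pi fun γ => continuous_pi fun x => ?_
    simp only [F, Matrix.eval_charpoly]
    exact (continuous_const.sub
      ((continuous_apply γ).comp (hcoe.comp continuous_subtype_val))).matrix_det
  refine T2Space.of_injective_continuous
    (f := Quot.lift F fun ρ ρ' ⟨g, hg⟩ => ?_) ?_ (continuous_quot_lift _ hF)
  · funext γ x
    simp only [F, hg, Units.val_mul, Matrix.coe_units_inv]
    rw [Matrix.charpoly_units_conj]
  · rintro ⟨ρ⟩ ⟨ρ'⟩ h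
    exact Quot.sound (ρ.2.exists_conj_of_charpoly_eq ρ'.2 fun γ =>
      Polynomial.funext fun x => congrFun (congrFun h γ) x)
end
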